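/- Let f : ℕ → K be an M-power series function, fix tuples s = (s_1,…,s_k) of non-negative integers and i = (i_1,…,i_k) with 0 ≤ i_j < M, and let s ≥ 1 be an integer. Define h : ℕ → K by h(n) = Σ_{0 < a < n, p | a} (f(a)/a^s)·σ_p(s;i)(a). Then there exist finitely many M-power series functions f_{(t,j)}, indexed by pairs of tuples (t,j) with t ≤ s' := (s_1,…,s_k,s), such that h(n) = Σ_{(t,j)} f_{(t,j)}(n)·σ_p(t;j)(n) for all n. -/

import Mathlib

open Filter

noncomputable section

variable {K : Type*}

/-- Evaluation of the power series with coefficients `c` at the point `x`, as a `tsum`. -/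
def evalPS [NormedField K] (c : ℕ → K) (x : K) : K := ∑' m, c m * x ^ m

/-- The power series with coefficients `c` converges on the closed disc of radius `r`,
i.e. `‖c m‖ * r ^ m → 0`. -/
def PSConvOn [NormedField K] (c : ℕ → K) (r : ℝ) : Prop :=
  Filter.Tendsto (fun m => ‖c m‖ * r ^ m) Filter.atTop (nhds 0)

/-- `f`, regarded as a function on `{n : ℕ // n₀ ≤ n}`, is an `M`-power series function:
for every `i` with `0 < i ≤ pM` there is a power series `cᵢ` converging on a closed disc of
radius `rᵢ > |p| = 1/p` such that `f a = cᵢ (a - i)` for all `a ≥ n₀` with `pM ∣ a - i`. -/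
def IsMPSF (p M n₀ : ℕ) [NormedField K] (f : ℕ → K) : Prop :=
  ∀ i : ℕ, 0 < i → i ≤ p * M →
    ∃ (r : ℝ) (c : ℕ → K), (p : ℝ)⁻¹ < r ∧ PSConvOn c r ∧
      ∀ a : ℕ, n₀ ≤ a → ((p : ℤ) * M) ∣ ((a : ℤ) - (i : ℤ)) →
        f a = evalPS c ((a : K) - (i : K))

open scoped Classical in
/-- The cyclotomic `p`-adic iterated sum series `σ(s;i;m)(n)`: the sum of
`ζ^(i₁n₁+⋯+iₖnₖ)/(n₁^{s₁}⋯nₖ^{sₖ})` over all tuples `0 < n₁ < ⋯ < nₖ < n`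
with `p ∣ nⱼ - mⱼ` for every `j`. -/
def cycSum (p : ℕ) [Field K] (ζ : K) {k : ℕ} (s i m : Fin k → ℕ) (n : ℕ) : K :=
  ∑ t ∈ (Fintype.piFinset fun _ : Fin k => Finset.Ioo 0 n).filter
      (fun t : Fin k → ℕ => StrictMono t ∧ ∀ j, (p : ℤ) ∣ ((t j : ℤ) - (m j : ℤ))),
    ∏ j, ζ ^ (i j * t j) / (t j : K) ^ (s j)

/-- `σ_p(s;i) = σ(s;i;0)`. -/
def sigmaP (p : ℕ) [Field K] (ζ : K) {k : ℕ} (s i : Fin k → ℕ) : ℕ → K :=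
  cycSum p ζ s i fun _ => 0

/-- The index set of all pairs of tuples `(s, i)` with `s` a tuple of naturals and
`i` a tuple of residues mod `M`, of a common length `k ≥ 0`. -/
def SIdx (M : ℕ) : Type := Σ k : ℕ, (Fin k → ℕ) × (Fin k → Fin M)

/-- The function `σ_p(s;i)` attached to an index `u = (s, i)`. -/
def sigmaPIdx (p M : ℕ) [Field K] (ζ : K) (u : SIdx M) : ℕ → K :=
  sigmaP p ζ u.2.1 fun j => ((u.2.2 j : ℕ))

/-- `t ≤ s` for tuples: there is a strictly increasing reindexing `j` with `tₐ ≤ s_{j(a)}`. -/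
def TupleLE {l k : ℕ} (t : Fin l → ℕ) (s : Fin k → ℕ) : Prop :=
  ∃ j : Fin l → Fin k, StrictMono j ∧ ∀ a, t a ≤ s (j a)

section Analytic

set_option linter.unusedSectionVars false

open Polynomial

/-- Gauss norm bound for polynomials. -/
def GBd [NormedField K] (ρ : ℝ) (P : K[X]) (B : ℝ) : Prop :=
  ∀ l, ‖P.coeff l‖ * ρ ^ l ≤ B

lemma GBd.add [NormedField K] [IsUltrametricDist K] {ρ : ℝ} (hρ : 0 < ρ) {P Q : K[X]} {B : ℝ}
    (hP : GBd ρ P B) (hQ : GBd ρ Q B) : GBd ρ (P + Q) B := by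
  intro l
  rw [coeff_add]
  have h := IsUltrametricDist.norm_add_le_max (P.coeff l) (Q.coeff l)
  have h0 : 0 ≤ ρ ^ l := by positivity
  rcases le_max_iff.1 h with h | h
  · exact (mul_le_mul_of_nonneg_right h h0).trans (hP l)
  · exact (mul_le_mul_of_nonneg_right h h0).trans (hQ l)

lemma GBd.mono [NormedField K] {ρ : ℝ} {P : K[X]} {B B' : ℝ}
    (hP : GBd ρ P B) (h : B ≤ B') : GBd ρ P B' := fun l => (hP l).trans h

lemma GBd.C_mul [NormedField K] {ρ : ℝ} {P : K[X]} {B : ℝ}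
    (hP : GBd ρ P B) (a : K) : GBd ρ (C a * P) (‖a‖ * B) := by
  intro l
  rw [coeff_C_mul, norm_mul, mul_assoc]
  exact mul_le_mul_of_nonneg_left (hP l) (norm_nonneg _)

lemma GBd.X_mul [NormedField K] {ρ : ℝ} (hρ : 0 < ρ) {P : K[X]} {B : ℝ}
    (hP : GBd ρ P B) : GBd ρ (X * P) (ρ * B) := by
  intro l
  cases l with
  | zero =>
    have h0 := hP 0
    have : 0 ≤ B := le_trans (by positivity) h0
    simp only [coeff_X_mul_zero, norm_zero, zero_mul]
    positivity
  | succ l =>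
    rw [coeff_X_mul, pow_succ, ← mul_assoc, mul_comm]
    exact mul_le_mul_of_nonneg_left (hP l) hρ.le

lemma GBd.nonneg [NormedField K] {ρ : ℝ} {P : K[X]} {B : ℝ}
    (hP : GBd ρ P B) : 0 ≤ B := le_trans (by positivity) (hP 0)

lemma GBd.linear_mul [NormedField K] [IsUltrametricDist K] {ρ : ℝ} (hρ : 0 < ρ) {P : K[X]}
    {B : ℝ} (hP : GBd ρ P B) (a : K) (ha : ‖a‖ ≤ ρ) : GBd ρ ((X + C a) * P) (ρ * B) := by
  rw [add_mul]
  exact (hP.X_mul hρ).add hρ ((hP.C_mul a).mono (mul_le_mul_of_nonneg_right ha hP.nonneg))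

lemma GBd.one [NormedField K] {ρ : ℝ} : GBd ρ (1 : K[X]) 1 := by
  intro l
  rw [coeff_one]
  split_ifs with h
  · subst h; simp
  · simp

variable [NormedField K] [CompleteSpace K] [IsUltrametricDist K]

/-- Substituting polynomials in a series. -/
lemma poly_subst (c : ℕ → K) (B : ℕ → K[X]) (ρ : ℝ) (hρ : 0 < ρ) (ε : ℕ → ℝ)
    (hε : Tendsto ε atTop (nhds 0)) (hB : ∀ m, GBd ρ (C (c m) * B m) (ε m)) :
    ∃ w : ℕ → K, PSConvOn w ρ ∧ ∀ z : K, ‖z‖ ≤ ρ →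
      Summable (fun m => c m * (B m).eval z) ∧ evalPS w z = ∑' m, c m * (B m).eval z := by
  have key : ∀ δ > 0, ∃ N L : ℕ, ∀ m l, (N ≤ m ∨ L ≤ l) → ‖c m * (B m).coeff l‖ * ρ ^ l < δ := by
    intro δ hδ
    obtain ⟨N, hN⟩ := eventually_atTop.1 (hε.eventually (gt_mem_nhds hδ))
    refine ⟨N, (Finset.range N).sup (fun m => (B m).natDegree) + 1, ?_⟩
    intro m l h
    by_cases hm : N ≤ m
    · have := hB m l
      rw [coeff_C_mul] at this
      exact this.trans_lt (hN m hm)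
    · have hl := h.resolve_left hm
      have h1 : (B m).natDegree ≤ (Finset.range N).sup (fun m => (B m).natDegree) :=
        Finset.le_sup (f := fun m => (B m).natDegree) (Finset.mem_range.2 (not_le.1 hm))
      rw [coeff_eq_zero_of_natDegree_lt (by omega)]
      simpa using hδ
  refine ⟨fun l => ∑' m, c m * (B m).coeff l, ?_, ?_⟩
  · rw [PSConvOn, Metric.tendsto_atTop]
    intro δ hδ
    obtain ⟨N, L, h⟩ := key (δ / 2) (half_pos hδ)
    refine ⟨L, fun l hl => ?_⟩
    have hρl : 0 < ρ ^ l := by positivity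
    have h2 : ‖∑' m, c m * (B m).coeff l‖ ≤ (δ / 2) / ρ ^ l := by
      apply IsUltrametricDist.norm_tsum_le_of_forall_le
      intro m
      rw [le_div_iff₀ hρl]
      exact (h m l (Or.inr hl)).le
    rw [le_div_iff₀ hρl] at h2
    rw [dist_zero_right, Real.norm_of_nonneg (by positivity)]
    linarith
  · intro z hz
    have hs : Summable (Function.uncurry fun m l => c m * (B m).coeff l * z ^ l) := by
      apply NonarchimedeanAddGroup.summable_of_tendsto_cofinite_zero
      rw [Metric.tendsto_nhds]
      intro δ hδ
      obtain ⟨N, L, h⟩ := key δ hδ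
      rw [Filter.eventually_cofinite]
      apply ((Finset.range N ×ˢ Finset.range L).finite_toSet).subset
      rintro ⟨m, l⟩ hml
      simp only [Set.mem_ofPred_eq, Function.uncurry, dist_zero_right, not_lt] at hml
      simp only [Finset.coe_product, Finset.coe_range, Set.mem_prod, Set.mem_Iio]
      by_contra hcon
      have := h m l (by omega)
      rw [norm_mul, norm_pow] at hml
      have h3 : ‖z‖ ^ l ≤ ρ ^ l := pow_le_pow_left₀ (norm_nonneg _) hz l
      have := mul_le_mul_of_nonneg_left h3 (norm_nonneg (c m * (B m).coeff l))
      linarith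
    have hev : ∀ m, ∑' l, c m * (B m).coeff l * z ^ l = c m * (B m).eval z := by
      intro m
      rw [eval_eq_sum_range, Finset.mul_sum]
      rw [tsum_eq_sum (s := Finset.range ((B m).natDegree + 1))]
      · simp [mul_assoc]
      · intro l hl
        rw [coeff_eq_zero_of_natDegree_lt (by simpa using hl)]
        simp
    constructor
    · have := hs.prod
      simpa only [Function.uncurry, hev] using this
    · have := hs.tsum_comm
      simp only [hev] at this
      rw [← this, evalPS]
      congr 1
      ext l
      rw [tsum_mul_right]

lemma PSConvOn.mono {c : ℕ → K} {r r' : ℝ} (h : PSConvOn c r) (h0 : 0 ≤ r') (hr : r' ≤ r) :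
    PSConvOn c r' := by
  refine squeeze_zero (fun m => by positivity) (fun m => ?_) h
  exact mul_le_mul_of_nonneg_left (pow_le_pow_left₀ h0 hr m) (norm_nonneg _)

lemma PSConvOn.summable {c : ℕ → K} {r : ℝ} (h : PSConvOn c r) {z : K} (hz : ‖z‖ ≤ r) :
    Summable (fun m => c m * z ^ m) := by
  apply NonarchimedeanAddGroup.summable_of_tendsto_cofinite_zero
  rw [Nat.cofinite_eq_atTop, tendsto_zero_iff_norm_tendsto_zero]
  refine squeeze_zero (fun m => by positivity) (fun m => ?_) h
  rw [norm_mul, norm_pow]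
  exact mul_le_mul_of_nonneg_left (pow_le_pow_left₀ (norm_nonneg _) hz m) (norm_nonneg _)

lemma recenter {c : ℕ → K} {r : ℝ} (hr : 0 < r) (h : PSConvOn c r) (x₀ : K) (hx : ‖x₀‖ ≤ r) :
    ∃ w, PSConvOn w r ∧ ∀ z, ‖z‖ ≤ r → evalPS w z = evalPS c (z + x₀) := by
  obtain ⟨w, hw, hw'⟩ := poly_subst c (fun m => (X + C x₀) ^ m) r hr _ h (by
    intro m
    apply GBd.C_mul
    induction m with
    | zero => simpa using GBd.one
    | succ m ih =>
      rw [pow_succ', pow_succ']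
      exact ih.linear_mul hr _ hx)
  refine ⟨w, hw, fun z hz => ?_⟩
  rw [(hw' z hz).2, evalPS]
  simp

lemma antidiff_poly (h : K) (hh : h ≠ 0) (ρ : ℝ) (hρ : ‖h‖ ≤ ρ)
    (hlow : ∀ n : ℕ, 1 ≤ n → (n : ℝ)⁻¹ ≤ ‖(n : K)‖) (m : ℕ) : ∀ j : ℕ,
    ∃ B : K[X], (∀ z, B.eval (z + h) - B.eval z =
        z ^ m * (∏ t ∈ Finset.range j, (X + C (-(t * h)))).eval z) ∧
      GBd ρ B ((m + j + 1 : ℕ) * ρ ^ (m + j) * (ρ / ‖h‖)) := by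
  have hh' : 0 < ‖h‖ := norm_pos_iff.2 hh
  have hρ0 : 0 < ρ := hh'.trans_le hρ
  have hnat : ∀ n : ℕ, ‖(n : K)‖ ≤ 1 := fun n => IsUltrametricDist.norm_natCast_le_one K n
  have hff : ∀ j : ℕ, GBd ρ (∏ t ∈ Finset.range j, (X + C (-(t * h)))) (ρ ^ j) := by
    intro j
    induction j with
    | zero => simpa using GBd.one
    | succ j ih =>
      rw [Finset.prod_range_succ, mul_comm, pow_succ']
      apply ih.linear_mul hρ0
      rw [norm_neg, norm_mul]
      nlinarith [hnat j]
  have hsh : ∀ (j : ℕ) (z : K), (∏ t ∈ Finset.range (j + 1), (X + C (-(t * h)))).eval (z + h)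
      = (z + h) * (∏ t ∈ Finset.range j, (X + C (-(t * h)))).eval z := by
    intro j z
    rw [Finset.prod_range_succ', eval_mul, eval_prod, eval_prod, mul_comm]
    simp
    left
    apply Finset.prod_congr rfl
    intros; ring
  induction m with
  | zero =>
    intro j
    have hj : ((j + 1 : ℕ) : K) ≠ 0 := by
      have := hlow (j + 1) (by omega)
      intro h0
      rw [h0, norm_zero] at this
      have : (0 : ℝ) < ((j + 1 : ℕ) : ℝ)⁻¹ := by positivity
      linarith
    refine ⟨C ((((j + 1 : ℕ) : K) * h)⁻¹) * ∏ t ∈ Finset.range (j + 1), (X + C (-(t * h))), ?_, ?_⟩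
    · intro z
      rw [eval_mul, eval_mul, hsh, Finset.prod_range_succ, eval_mul]
      simp only [eval_C, eval_add, eval_X]
      push_cast at hj ⊢
      field_simp
      ring
    · refine ((hff (j + 1)).C_mul _).mono ?_
      rw [norm_inv, norm_mul, mul_inv]
      have h1 : ‖((j + 1 : ℕ) : K)‖⁻¹ ≤ (j + 1 : ℕ) := by
        apply inv_le_of_inv_le₀ (by positivity)
        exact hlow (j + 1) (by omega)
      simp only [zero_add]
      calc ‖((j + 1 : ℕ) : K)‖⁻¹ * ‖h‖⁻¹ * ρ ^ (j + 1) ≤ (j + 1 : ℕ) * ‖h‖⁻¹ * ρ ^ (j + 1) := by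
            gcongr
        _ = _ := by rw [pow_succ, div_eq_mul_inv]; ring
  | succ m ih =>
    intro j
    obtain ⟨B₁, h₁, b₁⟩ := ih (j + 1)
    obtain ⟨B₂, h₂, b₂⟩ := ih j
    refine ⟨B₁ + C (j * h) * B₂, ?_, ?_⟩
    · intro z
      have e1 := h₁ z
      have e2 := h₂ z
      rw [Finset.prod_range_succ, eval_mul] at e1
      simp only [eval_add, eval_mul, eval_C, eval_X] at e1 ⊢
      linear_combination e1 + j * h * e2
    · apply GBd.add hρ0
      · refine b₁.mono (le_of_eq ?_)
        rw [show m + (j + 1) = m + 1 + j by ring]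
      · refine (b₂.C_mul _).mono ?_
        rw [norm_mul, show m + 1 + j = m + j + 1 by ring, pow_succ]
        have : ‖(j : K)‖ * ‖h‖ ≤ ρ := by nlinarith [hnat j]
        calc _ ≤ ρ * (((m + j + 1 : ℕ) : ℝ) * ρ ^ (m + j) * (ρ / ‖h‖)) := by gcongr
          _ = ((m + j + 1 : ℕ) : ℝ) * (ρ ^ (m + j) * ρ) * (ρ / ‖h‖) := by ring
          _ ≤ _ := by
            have h3 : ((m + j + 1 : ℕ) : ℝ) ≤ ((m + j + 1 + 1 : ℕ) : ℝ) := by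
              exact_mod_cast Nat.le_succ _
            gcongr

lemma antidiff (h : K) (hh : h ≠ 0)
    (hlow : ∀ n : ℕ, 1 ≤ n → (n : ℝ)⁻¹ ≤ ‖(n : K)‖) (c : ℕ → K) (r : ℝ) (hr : ‖h‖ < r)
    (hc : PSConvOn c r) :
    ∃ (ρ : ℝ) (w : ℕ → K), ‖h‖ < ρ ∧ PSConvOn w ρ ∧
      ∀ z, ‖z‖ ≤ ρ → evalPS w (z + h) - evalPS w z = evalPS c z := by
  obtain ⟨ρ, h1, h2⟩ := exists_between hr
  have hh' : 0 < ‖h‖ := norm_pos_iff.2 hh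
  have hρ0 : 0 < ρ := hh'.trans h1
  choose B hB1 hB2 using fun m => antidiff_poly h hh ρ h1.le hlow m 0
  have hε : Tendsto (fun m : ℕ => ‖c m‖ * (((m + 0 + 1 : ℕ) : ℝ) * ρ ^ (m + 0) * (ρ / ‖h‖)))
      atTop (nhds 0) := by
    have t1 : Tendsto (fun m : ℕ => ((m : ℝ) + 1) * (ρ / r) ^ m) atTop (nhds 0) := by
      have a1 := tendsto_self_mul_const_pow_of_lt_one (r := ρ / r)
        (div_nonneg hρ0.le (by linarith))
        ((div_lt_one (by linarith)).2 h2)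
      have a2 := tendsto_pow_atTop_nhds_zero_of_lt_one (r := ρ / r)
        (div_nonneg hρ0.le (by linarith)) ((div_lt_one (by linarith)).2 h2)
      have := a1.add a2
      simp only [add_zero] at this
      refine this.congr (fun m => by ring)
    have := (hc.mul t1).mul_const (ρ / ‖h‖)
    simp only [mul_zero, zero_mul] at this
    refine this.congr (fun m => ?_)
    have : r ≠ 0 := by linarith
    rw [div_pow]
    push_cast
    field_simp
    simp
  obtain ⟨w, hw, hw'⟩ := poly_subst c B ρ hρ0 _ hε (fun m => (hB2 m).C_mul _)
  refine ⟨ρ, w, h1, hw, fun z hz => ?_⟩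
  have hz' : ‖z + h‖ ≤ ρ := (IsUltrametricDist.norm_add_le_max z h).trans (max_le hz h1.le)
  rw [(hw' _ hz').2, (hw' _ hz).2, ← Summable.tsum_sub (hw' _ hz').1 (hw' _ hz).1, evalPS]
  congr 1
  ext m
  have := hB1 m z
  simp only [Finset.range_zero, Finset.prod_empty, eval_one, mul_one] at this
  rw [← mul_sub, this]

end Analytic
section MPSF

set_option linter.unusedSectionVars false
set_option linter.unusedVariables false

variable {p M : ℕ}

/-- `f` is given by a power series on the residue class of `i`. -/
def ClassRep (p M : ℕ) [NormedField K] (f : ℕ → K) (i : ℕ) : Prop :=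
  ∃ (r : ℝ) (c : ℕ → K), (p : ℝ)⁻¹ < r ∧ PSConvOn c r ∧
      ∀ a : ℕ, ((p : ℤ) * M) ∣ ((a : ℤ) - (i : ℤ)) → f a = evalPS c ((a : K) - (i : K))

lemma isMPSF_of_classRep [NormedField K] {f : ℕ → K} (h : ∀ i, ClassRep p M f i) :
    IsMPSF p M 0 f := by
  intro i _ _
  obtain ⟨r, c, h1, h2, h3⟩ := h i
  exact ⟨r, c, h1, h2, fun a _ => h3 a⟩

/-- The ambient assumptions on norms. -/
structure Amb (p M : ℕ) (K : Type*) [NormedField K] : Prop where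
  ppos : 0 < p
  Mpos : 0 < M
  pn : ‖(p : K)‖ = (p : ℝ)⁻¹
  Mn : ‖(M : K)‖ = 1
  low : ∀ n : ℕ, 1 ≤ n → (n : ℝ)⁻¹ ≤ ‖(n : K)‖

variable [NormedField K] [CompleteSpace K] [IsUltrametricDist K]

lemma norm_int_le (x : ℤ) : ‖(x : K)‖ ≤ 1 := IsUltrametricDist.norm_intCast_le_one K x

lemma Amb.norm_sub_le' (A : Amb p M K) {a b : ℤ} (h : (p : ℤ) ∣ a - b) :
    ‖(a : K) - (b : K)‖ ≤ (p : ℝ)⁻¹ := by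
  obtain ⟨x, hx⟩ := h
  have : (a : K) - b = p * x := by exact_mod_cast congrArg (Int.cast : ℤ → K) hx
  rw [this, norm_mul, A.pn]
  have h0 : (0 : ℝ) ≤ (p : ℝ)⁻¹ := by positivity
  have := norm_int_le (K := K) x
  nlinarith

lemma Amb.norm_nat_sub_le (A : Amb p M K) {a b : ℕ} (h : (p : ℤ) * M ∣ (a : ℤ) - b) :
    ‖(a : K) - (b : K)‖ ≤ (p : ℝ)⁻¹ := by
  have := A.norm_sub_le' (dvd_trans (Dvd.intro _ rfl) h)
  simpa using this

lemma Amb.norm_nat_le (A : Amb p M K) {a : ℕ} (h : p ∣ a) :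
    ‖(a : K)‖ ≤ (p : ℝ)⁻¹ := by
  have := A.norm_sub_le' (a := a) (b := 0) (by simpa using Int.natCast_dvd_natCast.2 h)
  simpa using this

lemma Amb.pinv (A : Amb p M K) : 0 < (p : ℝ)⁻¹ := by
  have := A.ppos
  positivity

lemma Amb.ne_zero (A : Amb p M K) {n : ℕ} (hn : 1 ≤ n) : (n : K) ≠ 0 := by
  have := A.low n hn
  intro h0
  rw [h0, norm_zero] at this
  have : (0 : ℝ) < (n : ℝ)⁻¹ := by positivity
  linarith

lemma IsMPSF.classRep (A : Amb p M K) {f : ℕ → K} (hf : IsMPSF p M 0 f) (i : ℕ) :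
    ClassRep p M f i := by
  have hpM : 0 < p * M := Nat.mul_pos A.ppos A.Mpos
  obtain ⟨i', h1, h2, h3⟩ : ∃ i' : ℕ, 0 < i' ∧ i' ≤ p * M ∧ ((p : ℤ) * M) ∣ (i : ℤ) - i' := by
    by_cases h : i % (p * M) = 0
    · refine ⟨p * M, hpM, le_rfl, ?_⟩
      have : ((p * M : ℕ) : ℤ) ∣ i := Int.natCast_dvd_natCast.2 (Nat.dvd_of_mod_eq_zero h)
      push_cast at this ⊢
      exact dvd_sub this dvd_rfl
    · refine ⟨i % (p * M), by omega, (Nat.mod_lt _ hpM).le, ?_⟩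
      push_cast
      exact Int.dvd_self_sub_emod
  obtain ⟨r, c, hr, hc, hrep⟩ := hf i' h1 h2
  have hr0 : 0 < r := A.pinv.trans hr
  obtain ⟨w, hw, hw'⟩ := recenter hr0 hc ((i : K) - i') ((A.norm_nat_sub_le h3).trans hr.le)
  refine ⟨r, w, hr, hw, fun a ha => ?_⟩
  rw [hw' _ ((A.norm_nat_sub_le ha).trans hr.le), hrep a (Nat.zero_le _)]
  · congr 1; ring
  · have := dvd_add ha h3
    simpa using this

lemma ClassRep.congr {f g : ℕ → K} {i : ℕ} (hf : ClassRep p M f i)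
    (h : ∀ a : ℕ, ((p : ℤ) * M) ∣ ((a : ℤ) - (i : ℤ)) → g a = f a) : ClassRep p M g i := by
  obtain ⟨r, c, h1, h2, h3⟩ := hf
  exact ⟨r, c, h1, h2, fun a ha => (h a ha).trans (h3 a ha)⟩

lemma ClassRep.add (A : Amb p M K) {f g : ℕ → K} {i : ℕ} (hf : ClassRep p M f i)
    (hg : ClassRep p M g i) : ClassRep p M (fun n => f n + g n) i := by
  obtain ⟨r, c, h1, h2, h3⟩ := hf
  obtain ⟨r', c', h1', h2', h3'⟩ := hg
  have hm : (p : ℝ)⁻¹ < min r r' := lt_min h1 h1'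
  have hm0 : 0 ≤ min r r' := (A.pinv.trans hm).le
  have k1 := h2.mono hm0 (min_le_left _ _)
  have k2 := h2'.mono hm0 (min_le_right _ _)
  refine ⟨min r r', fun m => c m + c' m, hm, ?_, ?_⟩
  · have := k1.add k2
    rw [add_zero] at this
    refine squeeze_zero (fun m => by positivity) (fun m => ?_) this
    rw [← add_mul]
    exact mul_le_mul_of_nonneg_right (norm_add_le _ _) (by positivity)
  · intro a ha
    have hn := (A.norm_nat_sub_le ha).trans hm.le
    beta_reduce
    rw [h3 a ha, h3' a ha, evalPS, evalPS, evalPS,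
      ← Summable.tsum_add (k1.summable hn) (k2.summable hn)]
    congr 1
    ext m
    ring

lemma ClassRep.const_mul {f : ℕ → K} {i : ℕ} (hf : ClassRep p M f i) (x : K) :
    ClassRep p M (fun n => x * f n) i := by
  obtain ⟨r, c, h1, h2, h3⟩ := hf
  refine ⟨r, fun m => x * c m, h1, ?_, ?_⟩
  · have := h2.const_mul ‖x‖
    rw [mul_zero] at this
    refine this.congr fun m => ?_
    rw [norm_mul, mul_assoc]
  · intro a ha
    beta_reduce
    rw [h3 a ha, evalPS, evalPS, ← tsum_mul_left]
    congr 1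
    ext m
    ring

lemma ClassRep.const (A : Amb p M K) (x : K) (i : ℕ) : ClassRep p M (fun _ => x) i := by
  refine ⟨(p : ℝ)⁻¹ + 1, fun m => if m = 0 then x else 0, by linarith, ?_, ?_⟩
  · apply tendsto_const_nhds.congr'
    filter_upwards [eventually_ge_atTop 1] with m hm
    simp [show m ≠ 0 by omega]
  · intro a _
    rw [evalPS, tsum_eq_single 0]
    · simp
    · intro m hm
      simp [hm]

lemma isMPSF_add (A : Amb p M K) {f g : ℕ → K} (hf : IsMPSF p M 0 f) (hg : IsMPSF p M 0 g) :
    IsMPSF p M 0 (fun n => f n + g n) :=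
  isMPSF_of_classRep fun i => (hf.classRep A i).add A (hg.classRep A i)

lemma isMPSF_const (A : Amb p M K) (x : K) : IsMPSF p M 0 (fun _ => x) :=
  isMPSF_of_classRep fun i => ClassRep.const A x i

lemma isMPSF_const_mul (A : Amb p M K) {f : ℕ → K} (hf : IsMPSF p M 0 f) (x : K) :
    IsMPSF p M 0 (fun n => x * f n) :=
  isMPSF_of_classRep fun i => (hf.classRep A i).const_mul x

lemma isMPSF_periodic_mul (A : Amb p M K) {f : ℕ → K} (hf : IsMPSF p M 0 f) (u : ℕ → K)
    (hu : ∀ a b : ℕ, a ≡ b [MOD p * M] → u a = u b) :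
    IsMPSF p M 0 (fun n => u n * f n) :=
  isMPSF_of_classRep fun i => ((hf.classRep A i).const_mul (u i)).congr fun a ha => by
    rw [hu a i]
    have : ((p * M : ℕ) : ℤ) ∣ (a : ℤ) - i := by exact_mod_cast ha
    exact ((Nat.modEq_iff_dvd).2 this).symm

lemma isMPSF_shift (A : Amb p M K) {f : ℕ → K} (hf : IsMPSF p M 0 f) (l : ℕ) :
    IsMPSF p M 0 (fun n => f (n + l)) := by
  refine isMPSF_of_classRep fun i => ?_
  obtain ⟨r, c, h1, h2, h3⟩ := hf.classRep A (i + l)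
  refine ⟨r, c, h1, h2, fun a ha => ?_⟩
  beta_reduce
  rw [h3 (a + l) (by push_cast; simpa using ha)]
  congr 1
  push_cast
  ring

lemma isMPSF_sum (A : Amb p M K) {ι : Type*} (S : Finset ι) (f : ι → ℕ → K)
    (hf : ∀ x ∈ S, IsMPSF p M 0 (f x)) :
    IsMPSF p M 0 (fun n => ∑ x ∈ S, f x n) := by
  classical
  induction S using Finset.induction_on with
  | empty => simpa using isMPSF_const A (0 : K)
  | insert x S hx ih =>
    simp only [Finset.sum_insert hx]
    exact isMPSF_add A (hf x (Finset.mem_insert_self _ _))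
      (ih fun y hy => hf y (Finset.mem_insert_of_mem hy))

lemma isMPSF_partial_sum (A : Amb p M K) {f : ℕ → K} (hf : IsMPSF p M 0 f) :
    IsMPSF p M 0 (fun n => ∑ a ∈ Finset.range n, if p ∣ a then f a else 0) := by
  set G : ℕ → K := fun n => ∑ a ∈ Finset.range n, if p ∣ a then f a else 0 with hG
  set D : ℕ → K := fun n => ∑ l ∈ Finset.range (p * M), (if p ∣ n + l then 1 else 0) * f (n + l)
    with hD
  have hDm : IsMPSF p M 0 D := by
    apply isMPSF_sum A
    intro l _
    apply isMPSF_periodic_mul A (isMPSF_shift A hf l) (fun n => if p ∣ n + l then 1 else 0)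
    intro a b hab
    have h1 : a + l ≡ b + l [MOD p] := (hab.of_mul_right M).add_right l
    simp only [h1.dvd_iff dvd_rfl]
  have hGD : ∀ n, G (n + p * M) = G n + D n := by
    intro n
    simp only [hG, hD]
    rw [Finset.sum_range_add]
    simp
  refine isMPSF_of_classRep fun i => ?_
  obtain ⟨r, c, h1, h2, h3⟩ := hDm.classRep A i
  have hn : ‖((p * M : ℕ) : K)‖ = (p : ℝ)⁻¹ := by
    push_cast
    rw [norm_mul, A.pn, A.Mn, mul_one]
  obtain ⟨ρ, w, k1, k2, k3⟩ := antidiff ((p * M : ℕ) : K)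
    (A.ne_zero (Nat.mul_pos A.ppos A.Mpos)) A.low c r (by rw [hn]; exact h1) h2
  rw [hn] at k1
  have hW : ClassRep p M (fun n => evalPS w ((n : K) - i)) i := ⟨ρ, w, k1, k2, fun a _ => rfl⟩
  have hstep : ∀ n : ℕ, ((p : ℤ) * M) ∣ ((n : ℤ) - (i : ℤ)) →
      G (n + p * M) - evalPS w (((n + p * M : ℕ) : K) - i) = G n - evalPS w ((n : K) - i) := by
    intro n hni
    have e := k3 ((n : K) - i) ((A.norm_nat_sub_le hni).trans k1.le)
    rw [← h3 n hni] at e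
    rw [hGD, ← e]
    push_cast
    rw [show (n : K) + p * M - i = n - i + p * M by ring]
    ring
  have hall : ∀ q n : ℕ, ((p : ℤ) * M) ∣ ((n : ℤ) - (i : ℤ)) →
      G (n + q * (p * M)) - evalPS w (((n + q * (p * M) : ℕ) : K) - i)
        = G n - evalPS w ((n : K) - i) := by
    intro q n hni
    induction q with
    | zero => simp
    | succ q ih =>
      rw [← ih, ← hstep (n + q * (p * M))]
      · rw [show n + q * (p * M) + p * M = n + (q + 1) * (p * M) by ring]
      · push_cast
        rw [show (n : ℤ) + q * (p * M) - i = (n - i) + (p * M) * q by ring]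
        exact dvd_add hni (dvd_mul_right _ _)
  have hmod : ∀ n : ℕ, ((p : ℤ) * M) ∣ ((n : ℤ) - (i : ℤ)) →
      G n - evalPS w ((n : K) - i) = G (i % (p * M)) - evalPS w (((i % (p * M) : ℕ) : K) - i) := by
    intro n hni
    have hni' : ((p * M : ℕ) : ℤ) ∣ (n : ℤ) - i := by exact_mod_cast hni
    have e : n % (p * M) = i % (p * M) := ((Nat.modEq_iff_dvd).2 hni').symm
    have e2 : n = i % (p * M) + (n / (p * M)) * (p * M) := by
      rw [← e]; exact (Nat.mod_add_div' n (p * M)).symm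
    have := hall (n / (p * M)) (i % (p * M)) (by
      have : ((p * M : ℕ) : ℤ) ∣ ((i % (p * M) : ℕ) : ℤ) - i :=
        (Nat.modEq_iff_dvd).1 (Nat.mod_modEq i (p * M)).symm
      exact_mod_cast this)
    rwa [← e2] at this
  refine (hW.add A (ClassRep.const A
    (G (i % (p * M)) - evalPS w (((i % (p * M) : ℕ) : K) - i)) i)).congr fun a ha => ?_
  rw [← hmod a ha]
  ring

/-- interpolation of a periodic function by characters -/
lemma interp (A : Amb p M K) {ζ : K} (hζ : IsPrimitiveRoot ζ M) (hcop : Nat.Coprime p M)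
    (Q : ℕ → K) (hQ : ∀ b, Q b = Q (b % M)) :
    ∃ q : ℕ → K, ∀ b, Q b = ∑ j ∈ Finset.range M, q j * ζ ^ (j * (p * b)) := by
  have hω : IsPrimitiveRoot (ζ ^ p) M := hζ.pow_of_coprime p hcop
  have hinj : Set.InjOn (fun c : ℕ => (ζ ^ p) ^ c) (Finset.range M : Set ℕ) := by
    intro a ha b hb hab
    simp only [Finset.coe_range, Set.mem_Iio] at ha hb
    exact hω.pow_inj ha hb hab
  set P := Lagrange.interpolate (Finset.range M) (fun c : ℕ => (ζ ^ p) ^ c) Q with hP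
  refine ⟨fun j => P.coeff j, fun b => ?_⟩
  have hb : b % M ∈ Finset.range M := Finset.mem_range.2 (Nat.mod_lt _ A.Mpos)
  have h1 := Lagrange.eval_interpolate_at_node Q hinj hb
  have hd : P.natDegree < M := by
    have := Lagrange.degree_interpolate_lt Q hinj
    rw [← hP, Finset.card_range] at this
    by_cases h0 : P = 0
    · rw [h0, Polynomial.natDegree_zero]; exact A.Mpos
    · exact (Polynomial.natDegree_lt_iff_degree_lt h0).2 this
  rw [← hP, Polynomial.eval_eq_sum_range' hd] at h1
  rw [hQ b, ← h1]
  apply Finset.sum_congr rfl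
  intro j _
  congr 1
  have : (ζ ^ p) ^ (b % M) = (ζ ^ p) ^ b := by
    conv_rhs => rw [← Nat.mod_add_div b M, pow_add, pow_mul _ M, hω.pow_eq_one, one_pow, mul_one]
  simp only [this]
  rw [← pow_mul, ← pow_mul]
  congr 1
  ring

lemma divide_step (A : Amb p M K) {ζ : K} (hζ : IsPrimitiveRoot ζ M) (hcop : Nat.Coprime p M)
    {f : ℕ → K} (hf : IsMPSF p M 0 f) :
    ∃ (q : ℕ → K) (g : ℕ → K), IsMPSF p M 0 g ∧ ∀ a : ℕ, p ∣ a →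
      f a = (∑ j ∈ Finset.range M, q j * ζ ^ (j * a)) + a * g a := by
  have hd : ∀ i : ℕ, ∃ (r : ℝ) (d : ℕ → K), p ∣ i → (p : ℝ)⁻¹ < r ∧ PSConvOn d r ∧
      ∀ a : ℕ, ((p : ℤ) * M) ∣ ((a : ℤ) - (i : ℤ)) → f a = evalPS d a := by
    intro i
    by_cases hi : p ∣ i
    · obtain ⟨r, c, h1, h2, h3⟩ := hf.classRep A i
      have hr0 : 0 < r := A.pinv.trans h1
      obtain ⟨w, hw, hw'⟩ := recenter hr0 h2 (-(i : K))
        (by rw [norm_neg]; exact (A.norm_nat_le hi).trans h1.le)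
      refine ⟨r, w, fun _ => ⟨h1, hw, fun a ha => ?_⟩⟩
      have hpa : p ∣ a := by
        have := dvd_add (dvd_trans (Dvd.intro _ rfl) ha) (Int.natCast_dvd_natCast.2 hi)
        rw [sub_add_cancel] at this
        exact_mod_cast this
      rw [hw' _ ((A.norm_nat_le hpa).trans h1.le), h3 a ha, sub_eq_add_neg]
    · exact ⟨0, fun _ => 0, fun h => absurd h hi⟩
  choose r d hd using hd
  have hmodp : ∀ a, p ∣ a % (p * M) ↔ p ∣ a := fun a => by
    rw [Nat.dvd_mod_iff (dvd_mul_right p M)]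
  have hself : ∀ a : ℕ, ((p : ℤ) * M) ∣ ((a : ℤ) - ((a % (p * M) : ℕ) : ℤ)) := by
    intro a
    push_cast
    exact Int.dvd_self_sub_emod
  set g : ℕ → K := fun a => if p ∣ a then evalPS (fun m => d (a % (p * M)) (m + 1)) a else 0
    with hg
  obtain ⟨q, hq⟩ := interp A hζ hcop (fun b => d ((p * b) % (p * M)) 0) (by
    intro b
    simp [Nat.mul_mod_mul_left])
  refine ⟨q, g, ?_, ?_⟩
  · refine isMPSF_of_classRep fun i => ?_
    have hpa : ∀ a : ℕ, ((p : ℤ) * M) ∣ ((a : ℤ) - (i : ℤ)) → a % (p * M) = i % (p * M) := by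
      intro a ha
      have hni' : ((p * M : ℕ) : ℤ) ∣ (a : ℤ) - i := by exact_mod_cast ha
      exact ((Nat.modEq_iff_dvd).2 hni').symm
    by_cases hi : p ∣ i
    · obtain ⟨h1, h2, h3⟩ := hd (i % (p * M)) ((hmodp i).2 hi)
      set j := i % (p * M)
      have hr0 : 0 < r j := A.pinv.trans h1
      have hsh : PSConvOn (fun m => d j (m + 1)) (r j) := by
        have := ((tendsto_add_atTop_iff_nat 1).2 h2).mul_const (r j)⁻¹
        rw [zero_mul] at this
        refine this.congr fun m => ?_
        rw [pow_succ]
        field_simp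
      obtain ⟨w, hw, hw'⟩ := recenter hr0 hsh (i : K) ((A.norm_nat_le hi).trans h1.le)
      refine ⟨r j, w, h1, hw, fun a ha => ?_⟩
      have : p ∣ a := by rw [← hmodp a, hpa a ha, hmodp]; exact hi
      rw [hw' _ ((A.norm_nat_sub_le ha).trans h1.le), sub_add_cancel]
      simp only [hg, if_pos this, hpa a ha]
    · refine (ClassRep.const A 0 i).congr fun a ha => ?_
      have : ¬ p ∣ a := by rw [← hmodp a, hpa a ha, hmodp]; exact hi
      simp only [hg, if_neg this]
  · intro a hpa
    obtain ⟨h1, h2, h3⟩ := hd (a % (p * M)) ((hmodp a).2 hpa)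
    have e1 := h3 a (hself a)
    have hs := h2.summable ((A.norm_nat_le hpa).trans h1.le)
    rw [evalPS, hs.tsum_eq_zero_add] at e1
    obtain ⟨b, rfl⟩ := hpa
    have e2 := hq b
    rw [← e2, e1]
    simp only [hg, if_pos (dvd_mul_right p b), evalPS, ← tsum_mul_left]
    simp only [pow_zero, mul_one]
    congr 1
    congr 1
    ext m
    rw [pow_succ]
    ring

end MPSF
section Combi

set_option linter.unusedSectionVars false

lemma strictMono_snoc_iff' {k : ℕ} (t : Fin k → ℕ) (a : ℕ) :
    StrictMono (Fin.snoc t a : Fin (k + 1) → ℕ) ↔ StrictMono t ∧ ∀ b, t b < a := by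
  constructor
  · intro h
    refine ⟨fun x y hxy => ?_, fun b => ?_⟩
    · have := h (Fin.castSucc_lt_castSucc_iff.2 hxy)
      simpa using this
    · have := h (Fin.castSucc_lt_last b)
      simpa using this
  · rintro ⟨h1, h2⟩ x y hxy
    induction y using Fin.lastCases with
    | last =>
      induction x using Fin.lastCases with
      | last => exact absurd hxy (lt_irrefl _)
      | cast x => simpa using h2 x
    | cast y =>
      induction x using Fin.lastCases with
      | last => exact absurd hxy (not_lt.2 (Fin.le_last _))
      | cast x => simpa using h1 (Fin.castSucc_lt_castSucc_iff.1 hxy)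

lemma sigmaP_snoc (p : ℕ) [Field K] (ζ : K) {k : ℕ} (s i : Fin k → ℕ) (s₀ j n : ℕ) :
    sigmaP p ζ (Fin.snoc s s₀ : Fin (k + 1) → ℕ) (Fin.snoc i j : Fin (k + 1) → ℕ) n =
      ∑ a ∈ (Finset.Ioo 0 n).filter (fun a => p ∣ a),
        ζ ^ (j * a) / (a : K) ^ s₀ * sigmaP p ζ s i a := by
  classical
  simp only [sigmaP, cycSum, Finset.mul_sum]
  rw [Finset.sum_sigma']
  have hcast : ∀ x : ℕ, (p : ℤ) ∣ (x : ℤ) - ((0 : ℕ) : ℤ) ↔ p ∣ x := by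
    intro x
    rw [Nat.cast_zero, sub_zero, Int.natCast_dvd_natCast]
  refine Finset.sum_bij' (fun t _ => ⟨t (Fin.last k), Fin.init t⟩)
    (fun x _ => (Fin.snoc x.2 x.1 : Fin (k + 1) → ℕ)) ?_ ?_ ?_ ?_ ?_
  · intro t ht
    obtain ⟨t, a, rfl⟩ : ∃ (t' : Fin k → ℕ) (a : ℕ), t = (Fin.snoc t' a : Fin (k + 1) → ℕ) :=
      ⟨Fin.init t, t (Fin.last k), (Fin.snoc_init_self t).symm⟩
    simp only [Finset.mem_filter, Fintype.mem_piFinset, Finset.mem_Ioo, strictMono_snoc_iff',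
      Fin.forall_fin_succ', Fin.snoc_castSucc, Fin.snoc_last, hcast, Finset.mem_sigma,
      Fin.init_snoc] at ht ⊢
    obtain ⟨⟨h1, h2⟩, ⟨h3, h4⟩, h5, h6⟩ := ht
    exact ⟨⟨h2, h6⟩, fun b => ⟨(h1 b).1, h4 b⟩, h3, h5⟩
  · rintro ⟨a, t⟩ ht
    simp only [Finset.mem_filter, Fintype.mem_piFinset, Finset.mem_Ioo, strictMono_snoc_iff',
      Fin.forall_fin_succ', Fin.snoc_castSucc, Fin.snoc_last, hcast, Finset.mem_sigma] at ht ⊢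
    obtain ⟨⟨h1, h2⟩, h3, h4, h5⟩ := ht
    exact ⟨⟨fun b => ⟨(h3 b).1, (h3 b).2.trans h1.2⟩, h1⟩, ⟨h4, fun b => (h3 b).2⟩, h5, h2⟩
  · intro t _
    exact Fin.snoc_init_self t
  · rintro ⟨a, t⟩ _
    simp
  · intro t _
    rw [Fin.prod_univ_castSucc, mul_comm]
    simp [Fin.init]

lemma sigmaP_zero (p : ℕ) [Field K] (ζ : K) (s i : Fin 0 → ℕ) (n : ℕ) :
    sigmaP p ζ s i n = 1 := by
  classical
  simp only [sigmaP, cycSum]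
  rw [Finset.filter_true_of_mem]
  · simp
  · intro t _
    exact ⟨fun x => x.elim0, fun x => x.elim0⟩

lemma TupleLE.refl {k : ℕ} (s : Fin k → ℕ) : TupleLE s s := ⟨id, strictMono_id, fun _ => le_rfl⟩

lemma TupleLE.snoc {l k : ℕ} {t : Fin l → ℕ} {s : Fin k → ℕ} (h : TupleLE t s) (x : ℕ) :
    TupleLE t (Fin.snoc s x : Fin (k + 1) → ℕ) := by
  obtain ⟨j, h1, h2⟩ := h
  exact ⟨fun a => (j a).castSucc, fun a b hab => Fin.castSucc_lt_castSucc_iff.2 (h1 hab),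
    fun a => by simpa using h2 a⟩

lemma TupleLE.mono_last {l k : ℕ} {t : Fin l → ℕ} {s : Fin k → ℕ} {x y : ℕ}
    (h : TupleLE t (Fin.snoc s x : Fin (k + 1) → ℕ)) (hxy : x ≤ y) :
    TupleLE t (Fin.snoc s y : Fin (k + 1) → ℕ) := by
  obtain ⟨j, h1, h2⟩ := h
  refine ⟨j, h1, fun a => (h2 a).trans ?_⟩
  induction j a using Fin.lastCases with
  | last => simpa using hxy
  | cast b => simp

lemma sum_Ioo_dvd [AddCommMonoid K] (p n : ℕ) (F : ℕ → K) :
    ∑ a ∈ (Finset.Ioo 0 n).filter (fun a => p ∣ a), F a =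
      ∑ a ∈ Finset.range n, if 0 < a ∧ p ∣ a then F a else 0 := by
  rw [← Finset.sum_filter]
  congr 1
  ext a
  simp only [Finset.mem_filter, Finset.mem_Ioo, Finset.mem_range]
  tauto

/-- `h` is a combination of `σ_p(u)`, `u` satisfying `P`, with MPSF coefficients. -/
def IsComb (p M : ℕ) [NormedField K] (ζ : K) (P : SIdx M → Prop) (h : ℕ → K) : Prop :=
  ∃ (T : Finset (SIdx M)) (c : SIdx M → ℕ → K),
    (∀ u ∈ T, IsMPSF p M 0 (c u) ∧ P u) ∧ ∀ n : ℕ, h n = ∑ u ∈ T, c u n * sigmaPIdx p M ζ u n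

variable {p M : ℕ} [NormedField K] {ζ : K}

lemma IsComb.mono {P Q : SIdx M → Prop} {h : ℕ → K} (H : IsComb p M ζ P h)
    (hPQ : ∀ u, P u → Q u) : IsComb p M ζ Q h := by
  obtain ⟨T, c, h1, h2⟩ := H
  exact ⟨T, c, fun u hu => ⟨(h1 u hu).1, hPQ u (h1 u hu).2⟩, h2⟩

lemma IsComb.congr {P : SIdx M → Prop} {h g : ℕ → K} (H : IsComb p M ζ P h)
    (hg : ∀ n, g n = h n) : IsComb p M ζ P g := by
  obtain ⟨T, c, h1, h2⟩ := H
  exact ⟨T, c, h1, fun n => (hg n).trans (h2 n)⟩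

lemma IsComb.zero {P : SIdx M → Prop} : IsComb p M ζ P (fun _ => 0) :=
  ⟨∅, fun _ _ => 0, by simp, by simp⟩

lemma IsComb.single {P : SIdx M → Prop} {f : ℕ → K} (hf : IsMPSF p M 0 f) (u : SIdx M)
    (hu : P u) : IsComb p M ζ P (fun n => f n * sigmaPIdx p M ζ u n) :=
  ⟨{u}, fun _ => f, by simpa using ⟨hf, hu⟩, by simp⟩

variable [CompleteSpace K] [IsUltrametricDist K]

lemma IsComb.add (A : Amb p M K) {P : SIdx M → Prop} {h g : ℕ → K} (H : IsComb p M ζ P h)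
    (G : IsComb p M ζ P g) : IsComb p M ζ P (fun n => h n + g n) := by
  classical
  obtain ⟨T, c, h1, h2⟩ := H
  obtain ⟨T', c', h1', h2'⟩ := G
  refine ⟨T ∪ T', fun u n => (if u ∈ T then c u n else 0) + (if u ∈ T' then c' u n else 0),
    ?_, ?_⟩
  · intro u hu
    constructor
    · apply isMPSF_add A
      · by_cases hT : u ∈ T
        · simpa only [hT, if_true] using (h1 u hT).1
        · simpa only [hT, if_false] using isMPSF_const A (0 : K)
      · by_cases hT : u ∈ T'
        · simpa only [hT, if_true] using (h1' u hT).1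
        · simpa only [hT, if_false] using isMPSF_const A (0 : K)
    · rcases Finset.mem_union.1 hu with h | h
      · exact (h1 u h).2
      · exact (h1' u h).2
  · intro n
    simp only [add_mul, Finset.sum_add_distrib, ite_mul, zero_mul]
    rw [← Finset.sum_filter, ← Finset.sum_filter, h2, h2']
    congr 1 <;> congr 1 <;> ext u <;> simp

lemma IsComb.sum (A : Amb p M K) {P : SIdx M → Prop} {ι : Type*} (S : Finset ι) (F : ι → ℕ → K)
    (hF : ∀ x ∈ S, IsComb p M ζ P (F x)) : IsComb p M ζ P (fun n => ∑ x ∈ S, F x n) := by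
  classical
  induction S using Finset.induction_on with
  | empty => simpa using IsComb.zero
  | insert x S hx ih =>
    simp only [Finset.sum_insert hx]
    exact (hF x (Finset.mem_insert_self _ _)).add A
      (ih fun y hy => hF y (Finset.mem_insert_of_mem hy))

lemma IsComb.single' (A : Amb p M K) {P : SIdx M → Prop} {f : ℕ → K} (hf : IsMPSF p M 0 f)
    {k : ℕ} (s i : Fin k → ℕ) (hi : ∀ b, i b < M) (hu : P ⟨k, s, fun b => ⟨i b, hi b⟩⟩) :
    IsComb p M ζ P (fun n => f n * sigmaP p ζ s i n) :=
  IsComb.single hf _ hu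

lemma snoc_lt {k : ℕ} {i : Fin k → ℕ} (hi : ∀ b, i b < M) {j : ℕ} (hj : j < M) :
    ∀ b, (Fin.snoc i j : Fin (k + 1) → ℕ) b < M := by
  intro b
  induction b using Fin.lastCases with
  | last => simpa using hj
  | cast b => simpa using hi b

lemma main_step (A : Amb p M K) (hζ : IsPrimitiveRoot ζ M) (hcop : Nat.Coprime p M) {k : ℕ}
    (s₀ : ℕ)
    (ih : ∀ (s i : Fin k → ℕ) (_ : ∀ b, i b < M) (f : ℕ → K) (_ : IsMPSF p M 0 f),
      IsComb p M ζ (fun u => TupleLE u.2.1 (Fin.snoc s s₀ : Fin (k + 1) → ℕ))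
        (fun n => ∑ a ∈ (Finset.Ioo 0 n).filter (fun a => p ∣ a),
          f a / (a : K) ^ s₀ * sigmaP p ζ s i a)) :
    ∀ (s i : Fin k → ℕ) (_ : ∀ b, i b < M) (f : ℕ → K) (_ : IsMPSF p M 0 f),
      IsComb p M ζ (fun u => TupleLE u.2.1 (Fin.snoc s (s₀ + 1) : Fin (k + 1) → ℕ))
        (fun n => ∑ a ∈ (Finset.Ioo 0 n).filter (fun a => p ∣ a),
          f a / (a : K) ^ (s₀ + 1) * sigmaP p ζ s i a) := by
  intro s i hi f hf
  obtain ⟨q, g, hg, hfg⟩ := divide_step A hζ hcop hf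
  have c1 := (ih s i hi g hg).mono (Q := fun u => TupleLE u.2.1
    (Fin.snoc s (s₀ + 1) : Fin (k + 1) → ℕ)) (fun u hu => hu.mono_last (Nat.le_succ _))
  have c2 := IsComb.sum (ζ := ζ) (P := fun u => TupleLE u.2.1
    (Fin.snoc s (s₀ + 1) : Fin (k + 1) → ℕ)) A (Finset.range M)
    (fun j n => q j * sigmaP p ζ (Fin.snoc s (s₀ + 1) : Fin (k + 1) → ℕ)
      (Fin.snoc i j : Fin (k + 1) → ℕ) n)
    (fun j hj => IsComb.single' A (isMPSF_const A (q j)) _ _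
      (snoc_lt hi (Finset.mem_range.1 hj)) (TupleLE.refl _))
  refine (c2.add A c1).congr fun n => ?_
  simp only [sigmaP_snoc, Finset.mul_sum]
  rw [Finset.sum_comm, ← Finset.sum_add_distrib]
  apply Finset.sum_congr rfl
  intro a ha
  simp only [Finset.mem_filter, Finset.mem_Ioo] at ha
  have ha0 : (a : K) ≠ 0 := A.ne_zero ha.1.1
  rw [hfg a ha.2, add_div, add_mul]
  congr 1
  · rw [Finset.sum_div, Finset.sum_mul]
    apply Finset.sum_congr rfl
    intro j _
    ring
  · rw [pow_succ]
    field_simp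

lemma main_aux (A : Amb p M K) (hζ : IsPrimitiveRoot ζ M) (hcop : Nat.Coprime p M) (k : ℕ) :
    ∀ (s₀ : ℕ) (s i : Fin k → ℕ) (_ : ∀ b, i b < M) (f : ℕ → K) (_ : IsMPSF p M 0 f),
      IsComb p M ζ (fun u => TupleLE u.2.1 (Fin.snoc s s₀ : Fin (k + 1) → ℕ))
        (fun n => ∑ a ∈ (Finset.Ioo 0 n).filter (fun a => p ∣ a),
          f a / (a : K) ^ s₀ * sigmaP p ζ s i a) := by
  induction k with
  | zero =>
    intro s₀
    induction s₀ with
    | zero =>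
      intro s i hi f hf
      have hG := isMPSF_partial_sum A hf
      have hG1 := isMPSF_const_mul A (isMPSF_partial_sum A (isMPSF_const A (1 : K))) (-(f 0))
      have c1 := IsComb.single' (ζ := ζ)
        (P := fun u => TupleLE u.2.1 (Fin.snoc s 0 : Fin (0 + 1) → ℕ)) A
        (isMPSF_add A hG hG1) s i hi ((TupleLE.refl s).snoc 0)
      have c2 := IsComb.single' (ζ := ζ)
        (P := fun u => TupleLE u.2.1 (Fin.snoc s 0 : Fin (0 + 1) → ℕ)) A
        (isMPSF_const A (f 0)) (Fin.snoc s 0 : Fin (0 + 1) → ℕ) (Fin.snoc i 0 : Fin (0 + 1) → ℕ)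
        (snoc_lt hi A.Mpos) (TupleLE.refl _)
      refine (c1.add A c2).congr fun n => ?_
      simp only [sigmaP_snoc, sigmaP_zero, sum_Ioo_dvd]
      simp only [mul_one, pow_zero, div_one, zero_mul]
      rcases n with _ | n
      · simp
      · induction n with
        | zero =>
          simp only [zero_add, Finset.sum_range_one]
          simp
        | succ n ih =>
          rw [Finset.sum_range_succ, ih]
          simp only [Finset.sum_range_succ _ (n + 1)]
          by_cases hp : p ∣ n + 1
          · simp [hp]
            ring
          · simp [hp]
    | succ s₀ ih =>
      exact main_step A hζ hcop s₀ ih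
  | succ k ihk =>
    intro s₀
    induction s₀ with
    | zero =>
      intro s i hi f hf
      obtain ⟨s', s₁, rfl⟩ : ∃ (s' : Fin k → ℕ) (a : ℕ), s = (Fin.snoc s' a : Fin (k + 1) → ℕ) :=
        ⟨Fin.init s, s (Fin.last k), (Fin.snoc_init_self s).symm⟩
      obtain ⟨i', i₁, rfl⟩ : ∃ (i' : Fin k → ℕ) (a : ℕ), i = (Fin.snoc i' a : Fin (k + 1) → ℕ) :=
        ⟨Fin.init i, i (Fin.last k), (Fin.snoc_init_self i).symm⟩
      have hi' : ∀ b, i' b < M := fun b => by simpa using hi b.castSucc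
      have hF := isMPSF_add A (isMPSF_partial_sum A hf) (isMPSF_const A (-(f 0)))
      set F : ℕ → K := fun n => (∑ a ∈ Finset.range n, if p ∣ a then f a else 0) + -(f 0) with hFd
      have hg : IsMPSF p M 0 (fun b => ζ ^ (i₁ * b) * (F b + f b)) := by
        apply isMPSF_periodic_mul A (isMPSF_add A hF hf) (fun b => ζ ^ (i₁ * b))
        intro a b hab
        have h2 : a ≡ b [MOD M] := hab.of_mul_left p
        have h3 : i₁ * a ≡ i₁ * b [MOD M] := h2.mul_left i₁
        have e : ∀ x : ℕ, ζ ^ x = ζ ^ (x % M) := fun x => by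
          rw [hζ.eq_orderOf, pow_mod_orderOf]
        beta_reduce
        rw [e (i₁ * a), e (i₁ * b), show i₁ * a % M = i₁ * b % M from h3]
      have c1 := IsComb.single' (ζ := ζ)
        (P := fun u => TupleLE u.2.1 (Fin.snoc (Fin.snoc s' s₁ : Fin (k + 1) → ℕ) 0 :
          Fin (k + 1 + 1) → ℕ)) A hF
        (Fin.snoc s' s₁ : Fin (k + 1) → ℕ) (Fin.snoc i' i₁ : Fin (k + 1) → ℕ) hi
        ((TupleLE.refl (Fin.snoc s' s₁ : Fin (k + 1) → ℕ)).snoc 0)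
      have c2 := (ihk s₁ s' i' hi' (fun b => -1 * (ζ ^ (i₁ * b) * (F b + f b)))
        (isMPSF_const_mul A hg (-1))).mono
        (Q := fun u => TupleLE u.2.1 (Fin.snoc (Fin.snoc s' s₁ : Fin (k + 1) → ℕ) 0 :
          Fin (k + 1 + 1) → ℕ)) (fun u hu => hu.snoc 0)
      refine (c1.add A c2).congr fun n => ?_
      have hFs : ∀ n, F (n + 1) = F n + if p ∣ n then f n else 0 := by
        intro n
        simp only [hFd, Finset.sum_range_succ]
        ring
      clear_value F
      simp only [sigmaP_snoc, sum_Ioo_dvd]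
      induction n with
      | zero => simp
      | succ n ih =>
        rw [Finset.sum_range_succ, ih, hFs]
        simp only [Finset.sum_range_succ _ n]
        by_cases hn : n = 0
        · subst hn
          simp
        · have hn' : 0 < n := Nat.pos_of_ne_zero hn
          by_cases hp : p ∣ n
          · simp only [hn', hp, and_self, if_true, pow_zero, div_one]
            ring
          · simp only [hp, and_false, if_false, add_zero]
    | succ s₀ ih =>
      exact main_step A hζ hcop s₀ ih

end Combi
/-- if `f` is an `M`-power series function and `s₀ ≥ 1` then
`h(n) = ∑_{0<a<n, p∣a} (f(a)/a^{s₀}) σ_p(s;i)(a)` equals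
`∑_{(t,j), t ≤ (s,s₀)} f_{(t,j)} σ_p(t;j)` for finitely many `M`-power series functions
`f_{(t,j)}`. -/
theorem sum_div_mul_sigmaP_isCombination (p M : ℕ) [Fact p.Prime] (hM : 1 ≤ M) (hpM : ¬ p ∣ M)
    [NormedField K] [CompleteSpace K] [Algebra ℚ_[p] K]
    (hiso : ∀ x : ℚ_[p], ‖algebraMap ℚ_[p] K x‖ = ‖x‖)
    (ζ : K) (hζ : IsPrimitiveRoot ζ M) (hgen : Algebra.adjoin ℚ_[p] {ζ} = ⊤)
    (f : ℕ → K) (hf : IsMPSF p M 0 f)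
    (k : ℕ) (s i : Fin k → ℕ) (hi : ∀ b, i b < M) (s₀ : ℕ) (hs₀ : 1 ≤ s₀) :
    ∃ (T : Finset (SIdx M)) (c : SIdx M → ℕ → K),
      (∀ u ∈ T, IsMPSF p M 0 (c u) ∧ TupleLE u.2.1 (Fin.snoc s s₀)) ∧
      ∀ n : ℕ,
        (∑ a ∈ (Finset.Ioo 0 n).filter (fun a => p ∣ a),
          f a / (a : K) ^ s₀ * sigmaP p ζ s i a) =
        ∑ u ∈ T, c u n * sigmaPIdx p M ζ u n := by
  have hprime : p.Prime := Fact.out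
  have hN : ∀ n : ℕ, ‖(n : K)‖ = ‖(n : ℚ_[p])‖ := fun n => by
    rw [← hiso, map_natCast]
  have hU : IsUltrametricDist K := by
    apply IsUltrametricDist.isUltrametricDist_of_forall_norm_natCast_le_one
    intro n
    rw [hN]
    exact IsUltrametricDist.norm_natCast_le_one ℚ_[p] n
  have hcop : Nat.Coprime p M := (Nat.Prime.coprime_iff_not_dvd hprime).2 hpM
  have A : Amb p M K := by
    refine ⟨hprime.pos, hM, ?_, ?_, ?_⟩
    · rw [hN, Padic.norm_p]
    · rw [hN, Padic.norm_natCast_eq_one_iff]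
      exact hcop
    · intro n hn
      have hn0 : (n : ℚ_[p]) ≠ 0 := by
        exact_mod_cast (by omega : n ≠ 0)
      rw [hN, Padic.norm_eq_zpow_neg_valuation hn0, Padic.valuation_natCast, zpow_neg,
        zpow_natCast]
      have h1 : p ^ padicValNat p n ≤ n := Nat.le_of_dvd hn pow_padicValNat_dvd
      have h2 : (0 : ℝ) < (p : ℝ) ^ padicValNat p n := by
        have := hprime.pos
        positivity
      exact inv_anti₀ h2 (by exact_mod_cast h1)
  exact main_aux A hζ hcop k s₀ s i hi f hf

end
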